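/- Let L > 0, let q : [0,L] → ℂ be continuous, and let f : [0,L] → ℂ be a twice continuously differentiable nonvanishing solution of f'' = q f with f(0) = 1. Define the transmuted heat polynomials H_n(x,t) = Σ_{k=0}^{⌊n/2⌋} c_k^n φ_{n−2k}(x) t^k, where φ_m are the formal powers associated with f and c_k^n = n!/((n−2k)! k!). Then for every n ∈ ℕ, the function H_n satisfies the equation ∂²H_n/∂x²(x,t) − q(x) H_n(x,t) = ∂H_n/∂t(x,t) for all x ∈ [0,L] and t ∈ ℝ. -/

import Mathlib

/-- The coefficient `c_k^n = n! / ((n - 2k)! k!)` of the heat polynomial. -/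
noncomputable def heatCoeff (n k : ℕ) : ℝ :=
  (Nat.factorial n : ℝ) / ((Nat.factorial (n - 2 * k) : ℝ) * (Nat.factorial k : ℝ))

/-- The recursive integrals `X^{(n)}` : `X^{(0)} ≡ 1`,
`X^{(n)}(x) = n ∫_0^x X^{(n-1)}(s) (f²(s))^{(-1)^n} ds`. -/
noncomputable def Xodd (f : ℝ → ℂ) : ℕ → ℝ → ℂ
  | 0, _ => 1
  | n + 1, x =>
      (n + 1 : ℂ) * ∫ s in (0 : ℝ)..x, Xodd f n s * (f s ^ 2) ^ ((-1 : ℤ) ^ (n + 1))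

/-- The recursive integrals `X̃^{(n)}` : `X̃^{(0)} ≡ 1`,
`X̃^{(n)}(x) = n ∫_0^x X̃^{(n-1)}(s) (f²(s))^{(-1)^{n-1}} ds`. -/
noncomputable def Xeven (f : ℝ → ℂ) : ℕ → ℝ → ℂ
  | 0, _ => 1
  | n + 1, x =>
      (n + 1 : ℂ) * ∫ s in (0 : ℝ)..x, Xeven f n s * (f s ^ 2) ^ ((-1 : ℤ) ^ n)

/-- The formal powers associated with `f`: `φ_n = f X^{(n)}` for odd `n` and
`φ_n = f X̃^{(n)}` for even `n`. -/
noncomputable def formalPower (f : ℝ → ℂ) (n : ℕ) (x : ℝ) : ℂ :=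
  if Odd n then f x * Xodd f n x else f x * Xeven f n x

/-- The transmuted heat polynomial
`H_n(x,t) = Σ_{k=0}^{⌊n/2⌋} c_k^n φ_{n-2k}(x) t^k`. -/
noncomputable def transmutedHeatPoly (f : ℝ → ℂ) (n : ℕ) (x t : ℝ) : ℂ :=
  ∑ k ∈ Finset.range (n / 2 + 1),
    (heatCoeff n k : ℂ) * formalPower f (n - 2 * k) x * (t : ℂ) ^ k

open Set in
lemma ftc_aux {L : ℝ} {h : ℝ → ℂ} (hh : ContinuousOn h (Icc 0 L)) (c : ℂ) {x : ℝ}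
    (hx : x ∈ Icc (0 : ℝ) L) :
    HasDerivWithinAt (fun y => c * ∫ s in (0 : ℝ)..y, h s) (c * h x) (Icc 0 L) x := by
  have : Fact (x ∈ Icc (0 : ℝ) L) := ⟨hx⟩
  refine HasDerivWithinAt.const_mul c ?_
  apply intervalIntegral.integral_hasDerivWithinAt_right
    (s := Icc 0 L) (t := Icc 0 L)
  · apply ContinuousOn.intervalIntegrable
    apply hh.mono
    rw [uIcc_of_le hx.1]
    exact Icc_subset_Icc_right hx.2
  · exact hh.stronglyMeasurableAtFilter_nhdsWithin measurableSet_Icc x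
  · exact hh x hx

lemma zpow_cont {s : Set ℝ} {f : ℝ → ℂ} (hf : ContinuousOn f s) (hne : ∀ x ∈ s, f x ≠ 0)
    (m : ℤ) : ContinuousOn (fun x => (f x ^ 2) ^ m) s :=
  (hf.pow 2).zpow₀ m (fun x hx => Or.inl (pow_ne_zero 2 (hne x hx)))

open Set in
lemma Xodd_cont {L : ℝ} {f : ℝ → ℂ} (hf : ContinuousOn f (Icc 0 L))
    (hne : ∀ x ∈ Icc 0 L, f x ≠ 0) (n : ℕ) : ContinuousOn (Xodd f n) (Icc 0 L) := by
  induction n with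
  | zero => exact continuousOn_const
  | succ n ih =>
    intro x hx
    exact (ftc_aux (ih.mul (zpow_cont hf hne _)) (n + 1 : ℂ) hx).continuousWithinAt

open Set in
lemma Xeven_cont {L : ℝ} {f : ℝ → ℂ} (hf : ContinuousOn f (Icc 0 L))
    (hne : ∀ x ∈ Icc 0 L, f x ≠ 0) (n : ℕ) : ContinuousOn (Xeven f n) (Icc 0 L) := by
  induction n with
  | zero => exact continuousOn_const
  | succ n ih =>
    intro x hx
    exact (ftc_aux (ih.mul (zpow_cont hf hne _)) (n + 1 : ℂ) hx).continuousWithinAt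

open Set in
lemma Xodd_deriv {L : ℝ} {f : ℝ → ℂ} (hf : ContinuousOn f (Icc 0 L))
    (hne : ∀ x ∈ Icc 0 L, f x ≠ 0) (n : ℕ) {x : ℝ} (hx : x ∈ Icc 0 L) :
    HasDerivWithinAt (Xodd f (n + 1))
      ((n + 1 : ℂ) * (Xodd f n x * (f x ^ 2) ^ ((-1 : ℤ) ^ (n + 1)))) (Icc 0 L) x :=
  ftc_aux ((Xodd_cont hf hne n).mul (zpow_cont hf hne _)) (n + 1 : ℂ) hx

open Set in
lemma Xeven_deriv {L : ℝ} {f : ℝ → ℂ} (hf : ContinuousOn f (Icc 0 L))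
    (hne : ∀ x ∈ Icc 0 L, f x ≠ 0) (n : ℕ) {x : ℝ} (hx : x ∈ Icc 0 L) :
    HasDerivWithinAt (Xeven f (n + 1))
      ((n + 1 : ℂ) * (Xeven f n x * (f x ^ 2) ^ ((-1 : ℤ) ^ n))) (Icc 0 L) x :=
  ftc_aux ((Xeven_cont hf hne n).mul (zpow_cont hf hne _)) (n + 1 : ℂ) hx

/-- Second derivative of `f u` where `u' = a v / f²`, `v' = b w f²`. -/
lemma second_aux {s : Set ℝ} {q f f' u v w : ℝ → ℂ} {a b : ℂ}
    (hf : ∀ x ∈ s, HasDerivWithinAt f (f' x) s x)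
    (hf' : ∀ x ∈ s, HasDerivWithinAt f' (q x * f x) s x)
    (hne : ∀ x ∈ s, f x ≠ 0)
    (hu : ∀ x ∈ s, HasDerivWithinAt u (a * (v x * (f x ^ 2)⁻¹)) s x)
    (hv : ∀ x ∈ s, HasDerivWithinAt v (b * (w x * f x ^ 2)) s x) :
    ∃ g : ℝ → ℂ, ∀ x ∈ s, HasDerivWithinAt (fun y => f y * u y) (g x) s x ∧
      HasDerivWithinAt g (q x * (f x * u x) + a * b * (f x * w x)) s x := by
  refine ⟨fun x => f' x * u x + a * (v x * (f x)⁻¹), fun x hx => ⟨?_, ?_⟩⟩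
  · refine ((hf x hx).mul (hu x hx)).congr_deriv ?_
    have := hne x hx
    field_simp
  · refine (((hf' x hx).mul (hu x hx)).add
      (((hv x hx).mul ((hf x hx).inv (hne x hx))).const_mul a)).congr_deriv ?_
    have := hne x hx
    simp only [Pi.inv_apply]
    field_simp
    ring

open Set in
lemma formalPower_second {L : ℝ} {q f f' : ℝ → ℂ}
    (hf : ∀ x ∈ Icc (0 : ℝ) L, HasDerivWithinAt f (f' x) (Icc 0 L) x)
    (hf' : ∀ x ∈ Icc (0 : ℝ) L, HasDerivWithinAt f' (q x * f x) (Icc 0 L) x)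
    (hne : ∀ x ∈ Icc (0 : ℝ) L, f x ≠ 0) (n : ℕ) :
    ∃ g : ℝ → ℂ, ∀ x ∈ Icc (0 : ℝ) L,
      HasDerivWithinAt (formalPower f n) (g x) (Icc 0 L) x ∧
      HasDerivWithinAt g (q x * formalPower f n x
        + (n : ℂ) * (n - 1) * formalPower f (n - 2) x) (Icc 0 L) x := by
  have hc : ContinuousOn f (Icc 0 L) := fun x hx => (hf x hx).continuousWithinAt
  match n with
  | 0 =>
    have h0 : formalPower f 0 = f := by
      funext x; simp [formalPower, Xeven]
    rw [h0]
    refine ⟨f', fun x hx => ⟨hf x hx, (hf' x hx).congr_deriv ?_⟩⟩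
    simp
  | 1 =>
    have h1 : formalPower f 1 = fun y => f y * Xodd f 1 y := by
      funext x; simp [formalPower]
    obtain ⟨g, hg⟩ := second_aux (a := 1) (b := 0) (u := Xodd f 1) (v := fun _ => 1)
      (w := fun _ => 0) hf hf' hne
      (fun x hx => (Xodd_deriv hc hne 0 hx).congr_deriv (by simp [Xodd]))
      (fun x hx => (hasDerivWithinAt_const x _ (1 : ℂ)).congr_deriv (by simp))
    refine ⟨g, fun x hx => ⟨h1 ▸ (hg x hx).1, (hg x hx).2.congr_deriv ?_⟩⟩
    simp [h1]
  | n + 2 =>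
    rcases Nat.even_or_odd n with he | ho
    · have e2 : ¬ Odd (n + 2) := by rw [Nat.not_odd_iff_even]; exact he.add even_two
      have e0 : ¬ Odd n := by rwa [Nat.not_odd_iff_even]
      have h1 : formalPower f (n + 2) = fun y => f y * Xeven f (n + 2) y := by
        funext x; simp only [formalPower, if_neg e2]
      obtain ⟨g, hg⟩ := second_aux (a := (n + 1 : ℕ) + 1) (b := n + 1) (u := Xeven f (n + 2))
        (v := Xeven f (n + 1)) (w := Xeven f n) hf hf' hne
        (fun x hx => (Xeven_deriv hc hne (n + 1) hx).congr_deriv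
          (by rw [he.add_one.neg_one_pow, zpow_neg_one]))
        (fun x hx => (Xeven_deriv hc hne n hx).congr_deriv
          (by rw [he.neg_one_pow, zpow_one]))
      refine ⟨g, fun x hx => ⟨h1 ▸ (hg x hx).1, (hg x hx).2.congr_deriv ?_⟩⟩
      rw [h1]
      simp only [Nat.add_sub_cancel, formalPower, if_neg e0]
      push_cast
      ring
    · have e2 : Odd (n + 2) := ho.add_even even_two
      have h1 : formalPower f (n + 2) = fun y => f y * Xodd f (n + 2) y := by
        funext x; simp only [formalPower, if_pos e2]
      obtain ⟨g, hg⟩ := second_aux (a := (n + 1 : ℕ) + 1) (b := n + 1) (u := Xodd f (n + 2))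
        (v := Xodd f (n + 1)) (w := Xodd f n) hf hf' hne
        (fun x hx => (Xodd_deriv hc hne (n + 1) hx).congr_deriv
          (by rw [show n + 1 + 1 = n + 2 from rfl, e2.neg_one_pow, zpow_neg_one]))
        (fun x hx => (Xodd_deriv hc hne n hx).congr_deriv
          (by rw [ho.add_one.neg_one_pow, zpow_one]))
      refine ⟨g, fun x hx => ⟨h1 ▸ (hg x hx).1, (hg x hx).2.congr_deriv ?_⟩⟩
      rw [h1]
      simp only [Nat.add_sub_cancel, formalPower, if_pos ho]
      push_cast
      ring

lemma heatCoeff_rec {n k : ℕ} (hk : k < n / 2) :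
    (heatCoeff n k : ℂ) * (((n - 2 * k : ℕ) : ℂ) * (((n - 2 * k : ℕ) : ℂ) - 1))
      = heatCoeff n (k + 1) * (k + 1) := by
  obtain ⟨m, hm⟩ : ∃ m, n - 2 * k = m + 2 := ⟨n - 2 * k - 2, by omega⟩
  have hm' : n - 2 * (k + 1) = m := by omega
  simp only [heatCoeff, hm, hm', Nat.factorial_succ]
  have h1 : ((m.factorial : ℕ) : ℂ) ≠ 0 := by exact_mod_cast m.factorial_ne_zero
  have h2 : ((k.factorial : ℕ) : ℂ) ≠ 0 := by exact_mod_cast k.factorial_ne_zero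
  have h3 : (m : ℂ) + 1 ≠ 0 := by exact_mod_cast m.succ_ne_zero
  have h4 : (m : ℂ) + 1 + 1 ≠ 0 := by exact_mod_cast (m + 1).succ_ne_zero
  have h5 : (k : ℂ) + 1 ≠ 0 := by exact_mod_cast k.succ_ne_zero
  push_cast
  field_simp
  ring

/-- Each transmuted heat polynomial `H_n` satisfies
`∂²H_n/∂x²(x,t) - q(x) H_n(x,t) = ∂H_n/∂t(x,t)` for `x ∈ [0,L]`, `t ∈ ℝ`. -/
theorem transmutedHeatPoly_satisfies_equation (L : ℝ) (hL : 0 < L) (q f f' : ℝ → ℂ)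
    (hq : ContinuousOn q (Set.Icc 0 L))
    (hf : ∀ x ∈ Set.Icc (0 : ℝ) L, HasDerivWithinAt f (f' x) (Set.Icc 0 L) x)
    (hf' : ∀ x ∈ Set.Icc (0 : ℝ) L, HasDerivWithinAt f' (q x * f x) (Set.Icc 0 L) x)
    (hf0 : f 0 = 1)
    (hfne : ∀ x ∈ Set.Icc (0 : ℝ) L, f x ≠ 0) :
    ∀ n : ℕ, ∀ x ∈ Set.Icc (0 : ℝ) L, ∀ t : ℝ,
      iteratedDerivWithin 2 (fun x' => transmutedHeatPoly f n x' t) (Set.Icc 0 L) x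
          - q x * transmutedHeatPoly f n x t
        = deriv (fun t' => transmutedHeatPoly f n x t') t := by
  intro n x hx t
  choose g hg using fun m => formalPower_second hf hf' hfne m
  have hud : UniqueDiffOn ℝ (Set.Icc (0 : ℝ) L) := uniqueDiffOn_Icc hL
  have d1 : ∀ y ∈ Set.Icc (0 : ℝ) L,
      HasDerivWithinAt (fun x' => transmutedHeatPoly f n x' t)
        (∑ k ∈ Finset.range (n / 2 + 1),
          (heatCoeff n k : ℂ) * g (n - 2 * k) y * (t : ℂ) ^ k) (Set.Icc 0 L) y := by
    intro y hy
    unfold transmutedHeatPoly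
    exact HasDerivWithinAt.fun_sum fun k _ =>
      (((hg (n - 2 * k) y hy).1.const_mul _).mul_const _)
  have d2 : HasDerivWithinAt (fun y => ∑ k ∈ Finset.range (n / 2 + 1),
          (heatCoeff n k : ℂ) * g (n - 2 * k) y * (t : ℂ) ^ k)
        (∑ k ∈ Finset.range (n / 2 + 1),
          (heatCoeff n k : ℂ) * (q x * formalPower f (n - 2 * k) x
            + ((n - 2 * k : ℕ) : ℂ) * (((n - 2 * k : ℕ) : ℂ) - 1)
              * formalPower f (n - 2 * k - 2) x) * (t : ℂ) ^ k) (Set.Icc 0 L) x :=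
    HasDerivWithinAt.fun_sum fun k _ =>
      (((hg (n - 2 * k) x hx).2.const_mul _).mul_const _)
  have d3 : HasDerivAt (fun t' : ℝ => transmutedHeatPoly f n x t')
      (∑ k ∈ Finset.range (n / 2 + 1),
        (heatCoeff n k : ℂ) * formalPower f (n - 2 * k) x * ((k : ℂ) * (t : ℂ) ^ (k - 1))) t := by
    unfold transmutedHeatPoly
    refine HasDerivAt.fun_sum fun k _ => HasDerivAt.const_mul _ ?_
    exact (hasDerivAt_pow k (t : ℂ)).comp_ofReal
  have e2 : iteratedDerivWithin 2 (fun x' => transmutedHeatPoly f n x' t) (Set.Icc 0 L) x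
      = ∑ k ∈ Finset.range (n / 2 + 1),
          (heatCoeff n k : ℂ) * (q x * formalPower f (n - 2 * k) x
            + ((n - 2 * k : ℕ) : ℂ) * (((n - 2 * k : ℕ) : ℂ) - 1)
              * formalPower f (n - 2 * k - 2) x) * (t : ℂ) ^ k := by
    rw [iteratedDerivWithin_succ, ← d2.derivWithin (hud x hx)]
    apply derivWithin_congr
    · intro y hy
      rw [iteratedDerivWithin_one]
      exact (d1 y hy).derivWithin (hud y hy)
    · rw [iteratedDerivWithin_one]
      exact (d1 x hx).derivWithin (hud x hx)
  rw [e2, d3.deriv]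
  unfold transmutedHeatPoly
  rw [Finset.mul_sum, ← Finset.sum_sub_distrib, Finset.sum_range_succ, Finset.sum_range_succ']
  have hlast : ((n - 2 * (n / 2) : ℕ) : ℂ) * (((n - 2 * (n / 2) : ℕ) : ℂ) - 1) = 0 := by
    have : n - 2 * (n / 2) = 0 ∨ n - 2 * (n / 2) = 1 := by omega
    rcases this with h | h <;> rw [h] <;> simp
  rw [hlast]
  congr 1
  · refine Finset.sum_congr rfl fun k hk => ?_
    have hr := heatCoeff_rec (Finset.mem_range.mp hk)
    have hi : n - 2 * k - 2 = n - 2 * (k + 1) := by omega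
    rw [hi, Nat.add_sub_cancel]
    push_cast
    linear_combination (formalPower f (n - 2 * (k + 1)) x * (t : ℂ) ^ k) * hr
  · push_cast
    ring
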